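/- arXiv:2105.01512 — 2 statements merged into one kernel-verified Lean document; each statement's English description precedes it below -/
import Mathlib

section
/- Let T be a Σ_I/Σ_O transducer, Λ ⊆ Σ_I^* a language, k > 0, and let D be any NFA recognizing L(Tr(T)) ∩ Λ (where Λ is identified with a language over Σ_I×Σ_O by ignoring the output component; e.g., D is the product of Tr(T) with an NFA for Λ). Then L(Perm_k(D)) = {(x,y) ∈ Σ_I^* × Σ_O^* : |x| = |y| = kR for some R ∈ ℕ, and there exists x' ≈_k x with x' ∈ Λ and T(x') ≈_k y}. -/
/-- A `Σ_I/Σ_O` transducer: states `Q`, initial state, transition function and labelling. -/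
structure Transducer (I O Q : Type*) where
  init : Q
  step : Q → I → Q
  label : Q → O

namespace Transducer

variable {I O Q : Type*}

/-- The output of the transducer read from state `q` (the label of `q` itself is ignored). -/
def outFrom (T : Transducer I O Q) : Q → List I → List O
  | _, [] => []
  | q, a :: x => T.label (T.step q a) :: T.outFrom (T.step q a) x

/-- The output `T(x)` of the transducer on the word `x`. -/
def out (T : Transducer I O Q) (x : List I) : List O :=
  T.outFrom T.init x

end Transducer

/-- `x ≈_k y` : the words have equal length and, for every `r`, the `r`-th `k`-round of `y`
is a permutation of the `r`-th `k`-round of `x` (equal Parikh vectors / letter multisets). -/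
def RoundEquiv {α : Type*} (k : ℕ) (x y : List α) : Prop :=
  x.length = y.length ∧
    ∀ r : ℕ, (↑((x.drop (k * r)).take k) : Multiset α) = ↑((y.drop (k * r)).take k)

/-- `T₂` `k`-round simulates `T₁` restricted to `Λ` (written `T₁ ≺_{k,Λ} T₂`). -/
def RoundSim {I O Q₁ Q₂ : Type*} (k : ℕ) (T₁ : Transducer I O Q₁) (T₂ : Transducer I O Q₂)
    (Λ : Set (List I)) : Prop :=
  ∀ x ∈ Λ, k ∣ x.length →
    ∃ x' : List I, RoundEquiv k x x' ∧ RoundEquiv k (T₁.out x) (T₂.out x')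

/-- `T₁ ≡_{k,Λ} T₂` : mutual `k`-round simulation restricted to `Λ`. -/
def RoundEquivT {I O Q₁ Q₂ : Type*} (k : ℕ) (T₁ : Transducer I O Q₁) (T₂ : Transducer I O Q₂)
    (Λ : Set (List I)) : Prop :=
  RoundSim k T₁ T₂ Λ ∧ RoundSim k T₂ T₁ Λ

/-- The trace DFA `Tr(T)` of a transducer: states `Option Q`, with `none` the rejecting
sink `q_⊥`; all states of `Q` are accepting. -/
def Transducer.trace {I O Q : Type*} [DecidableEq O] (T : Transducer I O Q) :
    DFA (I × O) (Option Q) where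
  step := fun q a => q.bind fun q' =>
    if T.label (T.step q' a.1) = a.2 then some (T.step q' a.1) else none
  start := some T.init
  accept := {q | q.isSome}

/-- The permutation-closure NFA `Perm_k(N)`. Letters are pairs `(α, β)` of a length-`k`
input block and a length-`k` output block; a step on `(α,β)` may follow `N` on any word
`(α',β')` obtained by permuting `α` and `β`. -/
def permNFA {I O S : Type*} (N : NFA (I × O) S) (k : ℕ) : NFA (List I × List O) S where
  step := fun s a =>
    {t | a.1.length = k ∧ a.2.length = k ∧
      ∃ (α : List I) (β : List O), (↑α : Multiset I) = ↑a.1 ∧ (↑β : Multiset O) = ↑a.2 ∧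
        t ∈ N.evalFrom {s} (α.zip β)}
  start := N.start
  accept := N.accept

/-- The type `τ_A(w)` of a word `w` in an NFA `A`: the Boolean matrix (here, a relation)
recording which pairs of states are connected by a run on `w`. -/
def NFA.wordType {α S : Type*} (N : NFA α S) (w : List α) : S → S → Prop :=
  fun s t => t ∈ N.evalFrom {s} w

/-- The type `τ_N(p,o)` of a pair of Parikh vectors (represented as multisets), defined as
the type in `Perm_k(N)` of any letter `(α,β)` with `𝔓(α) = p`, `𝔓(β) = o`. -/
def vecType {I O S : Type*} (N : NFA (I × O) S) (k : ℕ) (p : Multiset I) (o : Multiset O) :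
    S → S → Prop :=
  fun s t => t ∈ (permNFA N k).step s (p.toList, o.toList)

/-- The `k`-th type profile `Υ(N,k)`: the set of types of Parikh vectors of length-`k` blocks. -/
def typeProfile {I O S : Type*} (N : NFA (I × O) S) (k : ℕ) : Set (S → S → Prop) :=
  {τ | ∃ (p : Multiset I) (o : Multiset O),
    Multiset.card p = k ∧ Multiset.card o = k ∧ vecType N k p o = τ}

/-- Letterwise action of a permutation of `P` on a word over `2^P`. -/
def permuteWord {P : Type*} (π : Equiv.Perm P) (x : List (Set P)) : List (Set P) :=
  x.map fun σ => π '' σ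

/-- The permuted transducer `T^π`. -/
def Transducer.permuted {P Q : Type*} (T : Transducer (Set P) (Set P) Q) (π : Equiv.Perm P) :
    Transducer (Set P) (Set P) Q where
  init := T.init
  step := fun q σ => T.step q (⇑π⁻¹ '' σ)
  label := fun q => π '' T.label q

/-- `T` is `k`-round symmetric with respect to the permutation `π`. -/
def RoundSymmetricWrt {P Q : Type*} (T : Transducer (Set P) (Set P) Q) (π : Equiv.Perm P)
    (k : ℕ) : Prop :=
  ∀ x : List (Set P), k ∣ x.length →
    ∃ x' : List (Set P), RoundEquiv k (permuteWord π x) x' ∧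
      RoundEquiv k (permuteWord π (T.out x)) (T.out x')

namespace List

variable {α : Type*}

theorem toChunks_go_append (n : ℕ) (l rest : List α) (acc : Array α)
    (out : Array (List α)) (h : acc.size + l.length ≤ n) :
    toChunks.go n (l ++ rest) acc out =
      toChunks.go n rest (acc ++ l.toArray) out := by
  induction l generalizing acc with
  | nil => simp
  | cons a l ih =>
    simp only [length_cons] at h
    have hne : acc.size ≠ n := by omega
    rw [cons_append, toChunks.go, if_neg (by simpa using hne), ih _ (by simp; omega)]
    congr 1
    apply Array.ext'
    simp

theorem toChunks_go_flatten {n : ℕ} (hn : 0 < n) (c : List (List α))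
    (hc : ∀ b ∈ c, b.length = n) (acc : Array α) (out : Array (List α)) (h : acc.size = n) :
    toChunks.go n c.flatten acc out = out.toList ++ acc.toList :: c := by
  induction c generalizing acc out with
  | nil => simp [toChunks.go]
  | cons b c ih =>
    have hb : b.length = n := hc b (by simp)
    obtain _ | ⟨a, l⟩ := b
    · simp at hb; omega
    · simp only [length_cons] at hb
      rw [flatten_cons, cons_append, toChunks.go, if_pos (by simpa using h),
        toChunks_go_append _ _ _ _ _ (by simp; omega),
        ih (fun b hb => hc b (by simp [hb])) _ _ (by simp; omega)]
      simp

/-- Chunking the concatenation of blocks of length `n` recovers the blocks. -/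
theorem toChunks_flatten {n : ℕ} (hn : 0 < n) (c : List (List α))
    (hc : ∀ b ∈ c, b.length = n) : c.flatten.toChunks n = c := by
  obtain _ | ⟨b, c⟩ := c
  · simp [toChunks]
  have hb : b.length = n := hc b (by simp)
  obtain _ | ⟨a, l⟩ := b
  · simp at hb; omega
  simp only [length_cons] at hb
  obtain _ | m := n
  · omega
  rw [flatten_cons, cons_append, toChunks, toChunks_go_append _ _ _ _ _ (by simp; omega),
    toChunks_go_flatten hn c (fun b hb => hc b (by simp [hb])) _ _ (by simp; omega)]
  · simp
  · simp

theorem exists_flatten_eq_of_length_eq_mul (n R : ℕ) (x : List α) (hx : x.length = n * R) :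
    ∃ c : List (List α), c.length = R ∧ (∀ b ∈ c, b.length = n) ∧ c.flatten = x := by
  induction R generalizing x with
  | zero => exact ⟨[], by simp_all⟩
  | succ R ih =>
    rw [Nat.mul_succ] at hx
    obtain ⟨c, hR, hc, h⟩ := ih (x.drop n) (by simp; omega)
    refine ⟨x.take n :: c, by simp [hR], ?_, by simp [h]⟩
    intro b hb
    rcases mem_cons.1 hb with rfl | hb
    · simp; omega
    · exact hc b hb

theorem length_flatten_of_forall_length_eq {n : ℕ} (c : List (List α))
    (hc : ∀ b ∈ c, b.length = n) : c.flatten.length = n * c.length := by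
  induction c with
  | nil => simp
  | cons b c ih =>
    rw [flatten_cons, length_append, hc b (by simp), ih fun b hb => hc b (by simp [hb]),
      length_cons, Nat.mul_succ, Nat.add_comm]

end List

theorem Transducer.length_outFrom {I O Q : Type*} (T : Transducer I O Q) (q : Q) (x : List I) :
    (T.outFrom q x).length = x.length := by
  induction x generalizing q with
  | nil => rfl
  | cons a x ih => simp [outFrom, ih]

theorem Transducer.length_out {I O Q : Type*} (T : Transducer I O Q) (x : List I) :
    (T.out x).length = x.length :=
  T.length_outFrom T.init x

theorem RoundEquiv.symm {α : Type*} {k : ℕ} {x y : List α} (h : RoundEquiv k x y) :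
    RoundEquiv k y x :=
  ⟨h.1.symm, fun r => (h.2 r).symm⟩

theorem RoundEquiv.nil {α : Type*} (k : ℕ) : RoundEquiv k ([] : List α) [] :=
  ⟨rfl, fun _ => rfl⟩

theorem roundEquiv_nil_left {α : Type*} {k : ℕ} {y : List α} :
    RoundEquiv k [] y ↔ y = [] := by
  refine ⟨fun h => List.length_eq_zero_iff.1 h.1.symm, ?_⟩
  rintro rfl
  exact .nil k

theorem RoundEquiv.append {α : Type*} {k : ℕ} {a b x y : List α} (ha : a.length = k)
    (hab : (a : Multiset α) = b) (h : RoundEquiv k x y) : RoundEquiv k (a ++ x) (b ++ y) := by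
  have hb : b.length = k := by
    rw [← ha]; simpa using (congrArg Multiset.card hab).symm
  refine ⟨by simp [ha, hb, h.1], fun r => ?_⟩
  obtain _ | r := r
  · simpa [← ha, ← hb, List.take_append, hb.trans ha.symm] using hab
  · have hr : k * (r + 1) = k + k * r := by rw [Nat.mul_succ, Nat.add_comm]
    rw [hr, ← List.drop_drop, ← List.drop_drop, List.drop_left' ha, List.drop_left' hb]
    exact h.2 r

theorem RoundEquiv.exists_of_append_left {α : Type*} {k : ℕ} {a x y : List α}
    (ha : a.length = k) (h : RoundEquiv k (a ++ x) y) :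
    ∃ b z, y = b ++ z ∧ (b : Multiset α) = a ∧ RoundEquiv k x z := by
  refine ⟨y.take k, y.drop k, (List.take_append_drop k y).symm, ?_, ?_, fun r => ?_⟩
  · have := h.2 0
    simp only [Nat.mul_zero, List.drop_zero, List.take_left' ha] at this
    exact this.symm
  · have := h.1
    simp only [List.length_append, List.length_drop] at this ⊢
    omega
  · have := h.2 (r + 1)
    have hr : k * (r + 1) = k + k * r := by rw [Nat.mul_succ, Nat.add_comm]
    rw [hr, ← List.drop_drop, List.drop_left' ha] at this
    rwa [List.drop_drop]

/-- Runs of `permNFA N k` on `w` are the runs of `N` on words that are round equivalent to the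
concatenation of the blocks of `w`. -/
theorem mem_evalFrom_permNFA {I O S : Type*} (N : NFA (I × O) S) (k : ℕ) (A : Set S) (t : S)
    (w : List (List I × List O)) :
    t ∈ (permNFA N k).evalFrom A w ↔
      (∀ a ∈ w, a.1.length = k ∧ a.2.length = k) ∧
        ∃ x y, RoundEquiv k (w.map Prod.fst).flatten x ∧
          RoundEquiv k (w.map Prod.snd).flatten y ∧ t ∈ N.evalFrom A (x.zip y) := by
  induction w generalizing A with
  | nil => simp [roundEquiv_nil_left]
  | cons a w ih =>
    rw [NFA.evalFrom_cons, ih]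
    constructor
    · rintro ⟨hw, x, y, hx, hy, ht⟩
      obtain ⟨s', hs', ht⟩ := NFA.mem_evalFrom_iff_exists.1 ht
      obtain ⟨s, hs, h₁, h₂, α, β, hα, hβ, hs'⟩ := NFA.mem_stepSet.1 hs'
      refine ⟨by simpa [h₁, h₂] using hw, α ++ x, β ++ y, ?_, ?_, ?_⟩
      · exact RoundEquiv.append h₁ hα.symm hx
      · exact RoundEquiv.append h₂ hβ.symm hy
      · have hl : α.length = β.length := by
          have e₁ : α.length = a.1.length := by simpa using congrArg Multiset.card hα
          have e₂ : β.length = a.2.length := by simpa using congrArg Multiset.card hβ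
          omega
        rw [List.zip_append hl, NFA.evalFrom_append]
        exact NFA.mem_evalFrom_iff_exists.2
          ⟨s', NFA.mem_evalFrom_iff_exists.2 ⟨s, hs, hs'⟩, ht⟩
    · rintro ⟨hw, x, y, hx, hy, ht⟩
      obtain ⟨h₁, h₂⟩ := hw a (by simp)
      rw [List.map_cons, List.flatten_cons] at hx hy
      obtain ⟨α, x, rfl, hα, hx⟩ := hx.exists_of_append_left h₁
      obtain ⟨β, y, rfl, hβ, hy⟩ := hy.exists_of_append_left h₂
      have hl : α.length = β.length := by
        have e₁ : α.length = a.1.length := by simpa using congrArg Multiset.card hα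
        have e₂ : β.length = a.2.length := by simpa using congrArg Multiset.card hβ
        omega
      rw [List.zip_append hl, NFA.evalFrom_append] at ht
      obtain ⟨s', hs', ht⟩ := NFA.mem_evalFrom_iff_exists.1 ht
      obtain ⟨s, hs, hs'⟩ := NFA.mem_evalFrom_iff_exists.1 hs'
      exact ⟨fun b hb => hw b (by simp [hb]), x, y, hx, hy, NFA.mem_evalFrom_iff_exists.2
        ⟨s', NFA.mem_stepSet.2 ⟨s, hs, h₁, h₂, α, β, hα, hβ, hs'⟩, ht⟩⟩

/-- `permNFA N k` accepts the words of blocks that are round equivalent to a word accepted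
by `N`. -/
theorem mem_accepts_permNFA {I O S : Type*} (N : NFA (I × O) S) (k : ℕ)
    (w : List (List I × List O)) :
    w ∈ (permNFA N k).accepts ↔
      (∀ a ∈ w, a.1.length = k ∧ a.2.length = k) ∧
        ∃ x y, RoundEquiv k (w.map Prod.fst).flatten x ∧
          RoundEquiv k (w.map Prod.snd).flatten y ∧ x.zip y ∈ N.accepts := by
  simp only [NFA.mem_accepts, mem_evalFrom_permNFA]
  constructor
  · rintro ⟨t, ht, hw, x, y, hx, hy, h⟩
    exact ⟨hw, x, y, hx, hy, t, ht, h⟩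
  · rintro ⟨hw, x, y, hx, hy, t, ht, h⟩
    exact ⟨t, ht, hw, x, y, hx, hy, h⟩

/-- for any NFA `D` recognizing `L(Tr(T)) ∩ Λ` (with `Λ` lifted to the
alphabet `Σ_I × Σ_O` by ignoring the output component), the language of `Perm_k(D)`
consists of (the round encodings of) the pairs `(x,y)` with `|x| = |y| = kR` such that
some `x' ≈_k x` satisfies `x' ∈ Λ` and `T(x') ≈_k y`. -/
theorem permNFA_trace_inter_accepts {I O Q S : Type*} [DecidableEq O]
    (T : Transducer I O Q) (Λ : Set (List I)) (k : ℕ) (hk : 0 < k)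
    (D : NFA (I × O) S)
    (hD : ∀ w : List (I × O),
      w ∈ D.accepts ↔ (T.out (w.map Prod.fst) = w.map Prod.snd ∧ w.map Prod.fst ∈ Λ)) :
    (permNFA D k).accepts =
      {w : List (List I × List O) | ∃ (x : List I) (y : List O),
        w = (x.toChunks k).zip (y.toChunks k) ∧
        (∃ R : ℕ, x.length = k * R ∧ y.length = k * R) ∧
        ∃ x' : List I, RoundEquiv k x x' ∧ x' ∈ Λ ∧ RoundEquiv k (T.out x') y} := by
  ext w
  refine (mem_accepts_permNFA D k w).trans ?_
  constructor
  · rintro ⟨hw, x', y', hx, hy, h⟩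
    have hc₁ : ∀ b ∈ w.map Prod.fst, b.length = k := by
      intro b hb
      obtain ⟨a, ha, rfl⟩ := List.mem_map.1 hb
      exact (hw a ha).1
    have hc₂ : ∀ b ∈ w.map Prod.snd, b.length = k := by
      intro b hb
      obtain ⟨a, ha, rfl⟩ := List.mem_map.1 hb
      exact (hw a ha).2
    have l₁ := List.length_flatten_of_forall_length_eq _ hc₁
    have l₂ := List.length_flatten_of_forall_length_eq _ hc₂
    rw [List.length_map] at l₁ l₂
    have hl : x'.length = y'.length := by rw [← hx.1, ← hy.1, l₁, l₂]
    rw [hD, List.map_fst_zip hl.le, List.map_snd_zip hl.ge] at h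
    refine ⟨_, _, ?_, ⟨w.length, l₁, l₂⟩, x', hx, h.2, h.1 ▸ hy.symm⟩
    rw [List.toChunks_flatten hk _ hc₁, List.toChunks_flatten hk _ hc₂]
    exact List.zip_of_prod rfl rfl
  · rintro ⟨x, y, rfl, ⟨R, hxR, hyR⟩, x', hx, hx', hy⟩
    obtain ⟨c, hcR, hc, rfl⟩ := List.exists_flatten_eq_of_length_eq_mul k R x hxR
    obtain ⟨d, hdR, hd, rfl⟩ := List.exists_flatten_eq_of_length_eq_mul k R y hyR
    rw [List.toChunks_flatten hk _ hc, List.toChunks_flatten hk _ hd]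
    have hl := T.length_out x'
    refine ⟨fun a ha => ⟨hc _ (List.of_mem_zip ha).1, hd _ (List.of_mem_zip ha).2⟩,
      x', T.out x', ?_, ?_, ?_⟩
    · rwa [List.map_fst_zip (by omega)]
    · rw [List.map_snd_zip (by omega)]
      exact hy.symm
    · rw [hD, List.map_fst_zip hl.ge, List.map_snd_zip hl.le]
      exact ⟨rfl, hx'⟩
end

section
/- Round symmetry is inherently symmetric: let T be a 2^P/2^P transducer, k > 0, and π a permutation of the finite set P. If T^π ≺_k T, then T ≺_k T^π. -/
namespace RoundEquiv

variable {α β : Type*} {k : ℕ} {x y z : List α}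

theorem refl (k : ℕ) (x : List α) : RoundEquiv k x x :=
  ⟨rfl, fun _ => rfl⟩

theorem trans (h₁ : RoundEquiv k x y) (h₂ : RoundEquiv k y z) : RoundEquiv k x z :=
  ⟨h₁.1.trans h₂.1, fun r => (h₁.2 r).trans (h₂.2 r)⟩

theorem map (f : α → β) (h : RoundEquiv k x y) : RoundEquiv k (x.map f) (y.map f) := by
  refine ⟨by simpa using h.1, fun r => ?_⟩
  rw [← List.map_drop, ← List.map_drop, ← List.map_take, ← List.map_take,
    ← Multiset.map_coe, ← Multiset.map_coe, h.2 r]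

end RoundEquiv

section Permute

variable {P Q : Type*} {k : ℕ}

theorem RoundEquiv.permuteWord {x y : List (Set P)} (π : Equiv.Perm P) (h : RoundEquiv k x y) :
    RoundEquiv k (permuteWord π x) (permuteWord π y) :=
  h.map _

@[simp]
theorem length_permuteWord (π : Equiv.Perm P) (x : List (Set P)) :
    (permuteWord π x).length = x.length :=
  List.length_map _

@[simp]
theorem permuteWord_one (x : List (Set P)) : permuteWord 1 x = x := by
  simp [permuteWord]

theorem permuteWord_mul (π ρ : Equiv.Perm P) (x : List (Set P)) :
    permuteWord (π * ρ) x = permuteWord π (permuteWord ρ x) := by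
  simp [permuteWord, Set.image_image]

@[simp]
theorem permuteWord_permuteWord_inv (π : Equiv.Perm P) (x : List (Set P)) :
    permuteWord π (permuteWord π⁻¹ x) = x := by
  rw [← permuteWord_mul, mul_inv_cancel, permuteWord_one]

theorem Transducer.permuted_outFrom (T : Transducer (Set P) (Set P) Q) (π : Equiv.Perm P)
    (q : Q) (x : List (Set P)) :
    (T.permuted π).outFrom q (permuteWord π x) = permuteWord π (T.outFrom q x) := by
  induction x generalizing q with
  | nil => rfl
  | cons σ x ih =>
    have hσ : (⇑π⁻¹ '' (⇑π '' σ)) = σ := by simp [Set.image_image]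
    have hstep : (T.permuted π).step q (⇑π '' σ) = T.step q σ := congrArg (T.step q) hσ
    change (T.permuted π).label ((T.permuted π).step q (⇑π '' σ)) ::
      (T.permuted π).outFrom ((T.permuted π).step q (⇑π '' σ)) (permuteWord π x) = _
    rw [hstep, ih]
    rfl

theorem Transducer.permuted_out (T : Transducer (Set P) (Set P) Q) (π : Equiv.Perm P)
    (x : List (Set P)) :
    (T.permuted π).out (permuteWord π x) = permuteWord π (T.out x) :=
  T.permuted_outFrom π T.init x

namespace RoundSymmetricWrt

variable {T : Transducer (Set P) (Set P) Q} {π ρ : Equiv.Perm P}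

theorem one (T : Transducer (Set P) (Set P) Q) (k : ℕ) : RoundSymmetricWrt T 1 k := fun x _ =>
  ⟨x, by simpa using RoundEquiv.refl k x, by simpa using RoundEquiv.refl k (T.out x)⟩

theorem mul (hπ : RoundSymmetricWrt T π k) (hρ : RoundSymmetricWrt T ρ k) :
    RoundSymmetricWrt T (π * ρ) k := by
  intro x hx
  obtain ⟨y, hxy, hTxy⟩ := hρ x hx
  obtain ⟨z, hyz, hTyz⟩ := hπ y (by rwa [← hxy.1, length_permuteWord])
  refine ⟨z, ?_, ?_⟩ <;> rw [permuteWord_mul]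
  · exact (hxy.permuteWord π).trans hyz
  · exact (hTxy.permuteWord π).trans hTyz

theorem pow (hπ : RoundSymmetricWrt T π k) (n : ℕ) : RoundSymmetricWrt T (π ^ n) k := by
  induction n with
  | zero => exact one T k
  | succ n ih => exact pow_succ π n ▸ ih.mul hπ

theorem inv [Finite P] (hπ : RoundSymmetricWrt T π k) : RoundSymmetricWrt T π⁻¹ k := by
  have h : π ^ (orderOf π - 1) = π⁻¹ := by
    rw [eq_inv_iff_mul_eq_one, ← pow_succ, Nat.sub_add_cancel (orderOf_pos π), pow_orderOf_eq_one]
  exact h ▸ hπ.pow _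

end RoundSymmetricWrt

theorem RoundSim.roundSymmetricWrt {T : Transducer (Set P) (Set P) Q} {π : Equiv.Perm P}
    (h : RoundSim k (T.permuted π) T Set.univ) : RoundSymmetricWrt T π k := by
  intro x hx
  obtain ⟨y, hxy, hTxy⟩ := h (permuteWord π x) trivial (by rwa [length_permuteWord])
  exact ⟨y, hxy, by rwa [T.permuted_out] at hTxy⟩

theorem RoundSymmetricWrt.roundSim_permuted {T : Transducer (Set P) (Set P) Q}
    {π : Equiv.Perm P} (h : RoundSymmetricWrt T π⁻¹ k) :
    RoundSim k T (T.permuted π) Set.univ := by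
  intro x _ hx
  obtain ⟨y, hxy, hTxy⟩ := h x hx
  refine ⟨permuteWord π y, by simpa using hxy.permuteWord π, ?_⟩
  rw [T.permuted_out]
  simpa using hTxy.permuteWord π

end Permute

/-- if `T^π ≺_k T` then `T ≺_k T^π`. -/
theorem sim_symmetric {P Q : Type*} [Fintype P] (T : Transducer (Set P) (Set P) Q)
    (k : ℕ) (hk : 0 < k) (π : Equiv.Perm P)
    (hπ : RoundSim k (T.permuted π) T Set.univ) :
    RoundSim k T (T.permuted π) Set.univ :=
  hπ.roundSymmetricWrt.inv.roundSim_permuted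
end
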